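/- Let G be a simple graph, let o be an edge set that meets every finitely coverable cut evenly, let e ∈ o, and let u = {f ∈ o : o has nonempty intersection with every finitely coverable cut d such that no component of the graph obtained from G by deleting the edges of d contains both e and f}. Then u meets every finitely coverable cut evenly. -/

import Mathlib

open SimpleGraph

variable {V : Type}

/-- `c` is a cut of `G`: the set of edges with one endvertex in `A` and the other outside `A`,
for some set of vertices `A`. -/
def IsCut (G : SimpleGraph V) (c : Set (Sym2 V)) : Prop :=
  ∃ A : Set V, c = {e | e ∈ G.edgeSet ∧ ∃ x y, e = s(x, y) ∧ x ∈ A ∧ y ∉ A}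

/-- A set of edges is finitely coverable if some finite vertex set meets all its edges. -/
def FinitelyCoverable (c : Set (Sym2 V)) : Prop :=
  ∃ S : Set V, S.Finite ∧ ∀ e ∈ c, ∃ v ∈ S, v ∈ e

/-- `F` meets `X` evenly: their intersection is finite of even cardinality. -/
def MeetsEvenly (F X : Set (Sym2 V)) : Prop :=
  (F ∩ X).Finite ∧ Even (F ∩ X).ncard

/-- The edge `e` lies in the connected component `C` of `H`:
both endvertices of `e` belong to `C`. -/
def EdgeInComp (H : SimpleGraph V) (C : H.ConnectedComponent) (e : Sym2 V) : Prop :=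
  ∀ v ∈ e, H.connectedComponentMk v = C

/-- `F` is geometrically connected in `G`: `F` meets every finitely coverable cut `b`
such that two distinct components of `G` minus (the edges of) `b` contain edges of `F`. -/
def GeomConnected (G : SimpleGraph V) (F : Set (Sym2 V)) : Prop :=
  ∀ b : Set (Sym2 V), IsCut G b → FinitelyCoverable b →
    (∃ C D : (G.deleteEdges b).ConnectedComponent, C ≠ D ∧
      (∃ e ∈ F, EdgeInComp (G.deleteEdges b) C e) ∧
      (∃ f ∈ F, EdgeInComp (G.deleteEdges b) D f)) →
    (F ∩ b).Nonempty

/-- The vertex set (in `V`) of a connected component of an induced subgraph. -/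
def compSet (G : SimpleGraph V) {A : Set V} (C : (G.induce A).ConnectedComponent) : Set V :=
  Subtype.val '' C.supp

/-- The set of ends of `G`: compatible choices of a connected component of `G - S`
for every finite vertex set `S`. -/
def EndsOf (G : SimpleGraph V) :
    Set (∀ S : Finset V, (G.induce ((↑S : Set V)ᶜ)).ConnectedComponent) :=
  {ω | ∀ ⦃S S' : Finset V⦄, S ⊆ S' → compSet G (ω S') ⊆ compSet G (ω S)}

/-- An end of `G`. As a subspace of the product of the (discrete) sets of components,
this also carries the topology of the end space. -/
abbrev GraphEnd (G : SimpleGraph V) := ↥(EndsOf G)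

/-- The end `ω` lies in the closure of the edge set `F`: for every finite vertex set `S`
some edge of `F` has an endvertex in `ω(S)`. -/
def EndInClosure (G : SimpleGraph V) (ω : GraphEnd G) (F : Set (Sym2 V)) : Prop :=
  ∀ S : Finset V, ∃ e ∈ F, ∃ v ∈ e, v ∈ compSet G (ω.1 S)

/-- The vertex `v` dominates the end `ω`: for every finite vertex set `S` not containing `v`,
`v` has a neighbour in `ω(S)`. -/
def Dominates (G : SimpleGraph V) (v : V) (ω : GraphEnd G) : Prop :=
  ∀ S : Finset V, v ∉ S → ∃ w, G.Adj v w ∧ w ∈ compSet G (ω.1 S)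

/-- The sets of connected components carry the discrete topology; the end space is then
a subspace of the product of these discrete spaces. -/
instance (priority := 100) {α : Type} (H : SimpleGraph α) :
    TopologicalSpace H.ConnectedComponent := ⊥

/-- The edge boundary of a vertex set `A` in `G`. -/
def edgeBoundary (G : SimpleGraph V) (A : Set V) : Set (Sym2 V) :=
  {e | e ∈ G.edgeSet ∧ ∃ x y, e = s(x, y) ∧ x ∈ A ∧ y ∉ A}

theorem isCut_edgeBoundary (G : SimpleGraph V) (A : Set V) : IsCut G (edgeBoundary G A) :=
  ⟨A, rfl⟩

theorem mk_mem_edgeBoundary {G : SimpleGraph V} {A : Set V} {x y : V} :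
    s(x, y) ∈ edgeBoundary G A ↔ G.Adj x y ∧ ¬(x ∈ A ↔ y ∈ A) := by
  constructor
  · rintro ⟨h, a, b, hab, ha, hb⟩
    refine ⟨h, ?_⟩
    rcases Sym2.eq_iff.1 hab with ⟨rfl, rfl⟩ | ⟨rfl, rfl⟩ <;> tauto
  · rintro ⟨h, hxy⟩
    refine ⟨h, ?_⟩
    by_cases hx : x ∈ A
    · exact ⟨x, y, rfl, hx, by tauto⟩
    · exact ⟨y, x, Sym2.eq_swap, by tauto, hx⟩

theorem edgeBoundary_inter_subset (G : SimpleGraph V) (A B : Set V) :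
    edgeBoundary G (A ∩ B) ⊆ edgeBoundary G A ∪ edgeBoundary G B := by
  intro e
  induction e with | _ x y
  simp only [Set.mem_union, mk_mem_edgeBoundary, Set.mem_inter_iff]
  tauto

theorem FinitelyCoverable.mono {c d : Set (Sym2 V)} (hd : FinitelyCoverable d) (h : c ⊆ d) :
    FinitelyCoverable c :=
  let ⟨S, hS, hcov⟩ := hd
  ⟨S, hS, fun e he => hcov e (h he)⟩

theorem FinitelyCoverable.union {c d : Set (Sym2 V)} (hc : FinitelyCoverable c)
    (hd : FinitelyCoverable d) : FinitelyCoverable (c ∪ d) := by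
  obtain ⟨S, hS, hSc⟩ := hc
  obtain ⟨T, hT, hTd⟩ := hd
  refine ⟨S ∪ T, hS.union hT, ?_⟩
  rintro e (he | he)
  · obtain ⟨v, hv, hve⟩ := hSc e he
    exact ⟨v, .inl hv, hve⟩
  · obtain ⟨v, hv, hve⟩ := hTd e he
    exact ⟨v, .inr hv, hve⟩

theorem FinitelyCoverable.edgeBoundary_inter {G : SimpleGraph V} {A B : Set V}
    (hA : FinitelyCoverable (edgeBoundary G A)) (hB : FinitelyCoverable (edgeBoundary G B)) :
    FinitelyCoverable (edgeBoundary G (A ∩ B)) :=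
  (hA.union hB).mono (edgeBoundary_inter_subset G A B)

/-- The boundary of a component of `G.deleteEdges d` consists of edges of `d`. -/
theorem edgeBoundary_supp_subset {G : SimpleGraph V} {d : Set (Sym2 V)}
    (C : (G.deleteEdges d).ConnectedComponent) : edgeBoundary G C.supp ⊆ d := by
  intro e
  induction e with | _ x y
  rw [mk_mem_edgeBoundary]
  rintro ⟨hxy, hne⟩
  by_contra hd
  have hadj : (G.deleteEdges d).Adj x y := deleteEdges_adj.2 ⟨hxy, hd⟩
  exact hne (by
    rw [ConnectedComponent.mem_supp_iff, ConnectedComponent.mem_supp_iff,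
      ConnectedComponent.sound hadj.reachable])

theorem mem_iff_mem_of_reachable_deleteEdges_edgeBoundary {G : SimpleGraph V} {A : Set V} {x y : V}
    (h : (G.deleteEdges (edgeBoundary G A)).Reachable x y) : x ∈ A ↔ y ∈ A := by
  obtain ⟨p⟩ := h
  induction p with
  | nil => rfl
  | cons hadj _ ih =>
    rw [deleteEdges_adj, mk_mem_edgeBoundary] at hadj
    tauto

/-- An edge that survives in `G.deleteEdges d` lies in the component of any of its endvertices. -/
theorem exists_edgeInComp {G : SimpleGraph V} {d : Set (Sym2 V)} {e : Sym2 V}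
    (he : e ∈ G.edgeSet) (hd : e ∉ d) :
    ∃ C : (G.deleteEdges d).ConnectedComponent, EdgeInComp (G.deleteEdges d) C e := by
  induction e with | _ x y
  have hadj : (G.deleteEdges d).Adj x y := deleteEdges_adj.2 ⟨he, hd⟩
  refine ⟨(G.deleteEdges d).connectedComponentMk x, fun v hv => ?_⟩
  rcases Sym2.mem_iff.1 hv with rfl | rfl
  · rfl
  · exact ConnectedComponent.sound hadj.symm.reachable

/-- If a finitely coverable cut avoids `o` and separates the edges `e` and `f` of `o`, then so does
the boundary of some vertex set that contains `e` and avoids `f`. -/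
theorem exists_edgeBoundary_separating {G : SimpleGraph V} {o d : Set (Sym2 V)} {e f : Sym2 V}
    (ho : o ⊆ G.edgeSet) (he : e ∈ o) (hf : f ∈ o) (hd : FinitelyCoverable d)
    (hod : Disjoint o d)
    (hsep : ∀ C : (G.deleteEdges d).ConnectedComponent,
      ¬ (EdgeInComp (G.deleteEdges d) C e ∧ EdgeInComp (G.deleteEdges d) C f)) :
    ∃ A : Set V, FinitelyCoverable (edgeBoundary G A) ∧ Disjoint o (edgeBoundary G A) ∧
      (∀ v ∈ e, v ∈ A) ∧ ∀ v ∈ f, v ∉ A := by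
  obtain ⟨C, hC⟩ := exists_edgeInComp (ho he) (hod.notMem_of_mem_left he)
  obtain ⟨D, hD⟩ := exists_edgeInComp (ho hf) (hod.notMem_of_mem_left hf)
  have hsub := edgeBoundary_supp_subset C
  refine ⟨C.supp, hd.mono hsub, hod.mono_right hsub, hC, fun v hv hvC => hsep C ⟨hC, ?_⟩⟩
  have hDC : D = C := (hD v hv).symm.trans hvC
  exact hDC ▸ hD

/-- Finitely many edges that can each be separated from `e` by a finitely coverable boundary
avoiding `o` can be separated from `e` simultaneously. -/
theorem exists_edgeBoundary_separating_of_finite {G : SimpleGraph V} {o T : Set (Sym2 V)}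
    {e : Sym2 V} (hT : T.Finite)
    (hsep : ∀ f ∈ T, ∃ A : Set V, FinitelyCoverable (edgeBoundary G A) ∧
      Disjoint o (edgeBoundary G A) ∧ (∀ v ∈ e, v ∈ A) ∧ ∀ v ∈ f, v ∉ A) :
    ∃ A : Set V, FinitelyCoverable (edgeBoundary G A) ∧ Disjoint o (edgeBoundary G A) ∧
      (∀ v ∈ e, v ∈ A) ∧ ∀ f ∈ T, ∀ v ∈ f, v ∉ A := by
  induction T, hT using Set.Finite.induction_on with
  | empty =>
    have h : edgeBoundary G Set.univ = ∅ := by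
      ext e
      simp [edgeBoundary]
    refine ⟨Set.univ, ?_, ?_, by simp, by simp⟩
    · exact ⟨∅, Set.finite_empty, by simp [h]⟩
    · simp [h]
  | @insert f T _ _ ih =>
    obtain ⟨A, hA, hoA, heA, hTA⟩ := ih fun g hg => hsep g (.inr hg)
    obtain ⟨B, hB, hoB, heB, hfB⟩ := hsep f (.inl rfl)
    refine ⟨A ∩ B, hA.edgeBoundary_inter hB,
      (hoA.union_right hoB).mono_right (edgeBoundary_inter_subset G A B),
      fun v hv => ⟨heA v hv, heB v hv⟩, ?_⟩
    rintro g (rfl | hg) v hv hvAB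
    · exact hfB v hv hvAB.2
    · exact hTA g hg v hv hvAB.1

/-- If no edge of `o` lies in the boundary of `A`, then the edges of `o` in the boundary of `A ∩ B`
are those in the boundary of `B` that do not avoid `A`. -/
theorem mem_edgeBoundary_inter_iff {G : SimpleGraph V} {A B : Set V} {f : Sym2 V}
    (hf : f ∉ edgeBoundary G A) :
    f ∈ edgeBoundary G (A ∩ B) ↔ f ∈ edgeBoundary G B ∧ ¬ ∀ v ∈ f, v ∉ A := by
  induction f with | _ x y
  simp only [mk_mem_edgeBoundary, Set.mem_inter_iff, Sym2.mem_iff, forall_eq_or_imp,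
    forall_eq] at hf ⊢
  tauto

/-- **Sublemma.** The geometric component u of e in o meets every finitely coverable
cut evenly. -/
theorem geometric_component_meets_cuts_evenly (G : SimpleGraph V) (o : Set (Sym2 V))
    (ho : o ⊆ G.edgeSet)
    (heven : ∀ c, IsCut G c → FinitelyCoverable c → MeetsEvenly o c)
    (e : Sym2 V) (he : e ∈ o) :
    ∀ c, IsCut G c → FinitelyCoverable c →
      MeetsEvenly {f | f ∈ o ∧ ∀ d, IsCut G d → FinitelyCoverable d →
        (∀ C : (G.deleteEdges d).ConnectedComponent,
          ¬ (EdgeInComp (G.deleteEdges d) C e ∧ EdgeInComp (G.deleteEdges d) C f)) →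
        (o ∩ d).Nonempty} c := by
  rintro c ⟨B, rfl⟩ hc
  change FinitelyCoverable (edgeBoundary G B) at hc
  change MeetsEvenly _ (edgeBoundary G B)
  set u : Set (Sym2 V) := {f | f ∈ o ∧ ∀ d, IsCut G d → FinitelyCoverable d →
        (∀ C : (G.deleteEdges d).ConnectedComponent,
          ¬ (EdgeInComp (G.deleteEdges d) C e ∧ EdgeInComp (G.deleteEdges d) C f)) →
        (o ∩ d).Nonempty} with hu
  have hfin : ((o \ u) ∩ edgeBoundary G B).Finite :=
    (heven _ (isCut_edgeBoundary G B) hc).1.subset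
      (Set.inter_subset_inter_left _ Set.sdiff_subset)
  obtain ⟨A, hA, hoA, heA, hTA⟩ :=
    exists_edgeBoundary_separating_of_finite (G := G) (o := o) (e := e) hfin (by
      rintro f ⟨⟨hfo, hfu⟩, -⟩
      simp only [hu, Set.mem_ofPred_eq, not_and, not_forall] at hfu
      obtain ⟨d, -, hd, hsep, hod⟩ := hfu hfo
      exact exists_edgeBoundary_separating ho he hfo hd
        (Set.disjoint_iff_inter_eq_empty.2 (Set.not_nonempty_iff_eq_empty.1 hod))
        (by simpa using hsep))
  have huA : ∀ f ∈ u, ¬ ∀ v ∈ f, v ∉ A := by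
    rintro f ⟨-, hf⟩ hfA
    refine Set.not_nonempty_iff_eq_empty.2 (Set.disjoint_iff_inter_eq_empty.1 hoA)
      (hf _ (isCut_edgeBoundary G A) hA ?_)
    rintro C ⟨heC, hfC⟩
    have hx := e.out_fst_mem
    have hy := f.out_fst_mem
    have hr := ConnectedComponent.exact ((heC _ hx).trans (hfC _ hy).symm)
    exact hfA _ hy ((mem_iff_mem_of_reachable_deleteEdges_edgeBoundary hr).1 (heA _ hx))
  have hkey : u ∩ edgeBoundary G B = o ∩ edgeBoundary G (A ∩ B) := by
    ext f
    constructor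
    · rintro ⟨hfu, hfB⟩
      exact ⟨hfu.1, (mem_edgeBoundary_inter_iff (hoA.notMem_of_mem_left hfu.1)).2
        ⟨hfB, huA f hfu⟩⟩
    · rintro ⟨hfo, hfAB⟩
      obtain ⟨hfB, hfA⟩ := (mem_edgeBoundary_inter_iff (hoA.notMem_of_mem_left hfo)).1 hfAB
      by_contra hfu
      exact hfA (hTA f ⟨⟨hfo, fun h => hfu ⟨h, hfB⟩⟩, hfB⟩)
  unfold MeetsEvenly
  rw [hkey]
  exact heven _ (isCut_edgeBoundary G _) (hA.edgeBoundary_inter hc)
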